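/- Let f ∈ ℚ[X] be a polynomial of degree at least 1. Let A = ℚ[t₁^{±1}, t₂^{±1}], set t₃ := t₁⁻¹·t₂⁻¹ ∈ A, and let R be the localization of A at the multiplicative set generated by f(t₁)·f(t₂)·f(t₃). Let x₁, x₂ ∈ R be the images of f(t₂) − f(t₁) and f(t₃) − f(t₂) respectively. Consider the complex of R-modules 0 → R →^{d⁰} R ⊕ R →^{d¹} R → 0 with d⁰(r) = (x₁·r, x₂·r) and d¹(y₁, y₂) = x₂·y₁ − x₁·y₂. Then d¹ ∘ d⁰ = 0, d⁰ is injective, the kernel of d¹ equals the image of d⁰, and the cokernel of d¹ is isomorphic as an R-module to R/(x₁, x₂), the quotient of R by the ideal generated by x₁ and x₂. -/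

import Mathlib

noncomputable section

/-- `A = ℚ[t₁^{±1}, t₂^{±1}]`, the Laurent polynomial ring in two variables over ℚ,
realized as the group algebra of `ℤ × ℤ` over `ℚ`. -/
abbrev LaurentTwo : Type := AddMonoidAlgebra ℚ (ℤ × ℤ)

/-- The variable `t₁`. -/
def t₁ : LaurentTwo := AddMonoidAlgebra.of' ℚ (ℤ × ℤ) (1, 0)

/-- The variable `t₂`. -/
def t₂ : LaurentTwo := AddMonoidAlgebra.of' ℚ (ℤ × ℤ) (0, 1)

/-- `t₃ = t₁⁻¹·t₂⁻¹`. -/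
def t₃ : LaurentTwo := AddMonoidAlgebra.of' ℚ (ℤ × ℤ) (-1, -1)

/-- `R`, the localization of `A` at the multiplicative set generated by
`f(t₁)·f(t₂)·f(t₃)`. -/
abbrev LocLaurentTwo (f : Polynomial ℚ) : Type :=
  Localization.Away (Polynomial.aeval t₁ f * Polynomial.aeval t₂ f * Polynomial.aeval t₃ f)

/-- The image of `f(t₂) − f(t₁)` in `R`. -/
def x₁ (f : Polynomial ℚ) : LocLaurentTwo f :=
  algebraMap LaurentTwo (LocLaurentTwo f) (Polynomial.aeval t₂ f - Polynomial.aeval t₁ f)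

/-- The image of `f(t₃) − f(t₂)` in `R`. -/
def x₂ (f : Polynomial ℚ) : LocLaurentTwo f :=
  algebraMap LaurentTwo (LocLaurentTwo f) (Polynomial.aeval t₃ f - Polynomial.aeval t₂ f)

open Polynomial in
/-- If `f` is nonconstant and takes the same value at three elements of a `k`-domain whose product
is `1`, then the first two are integral over `k`: by the valuative criterion their common value
is integral over `k`, since every valuation ring contains one of the three elements. -/
lemma isIntegral_of_aeval_eq_of_mul_eq_one {k B : Type*} [Field k] [CommRing B] [IsDomain B]
    [Algebra k B] {f : k[X]} (hf : 1 ≤ f.natDegree) {a b c : B} (habc : a * b * c = 1)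
    (hab : aeval b f = aeval a f) (hbc : aeval c f = aeval b f) :
    IsIntegral k a ∧ IsIntegral k b := by
  let K := FractionRing B
  have hinj : Function.Injective (algebraMap B K) := IsFractionRing.injective B K
  have hv : IsIntegral k (algebraMap B K (aeval a f)) := by
    by_contra h
    let R := (integralClosure k K).toSubring
    have : IsIntegrallyClosedIn R K :=
      inferInstanceAs (IsIntegrallyClosedIn (integralClosure k K) K)
    obtain ⟨V, hRV, hV⟩ := R.exists_le_valuationSubring_of_isIntegrallyClosedIn h
    have hmem (x : K) (hx : x ∈ V) : aeval x f ∈ V := by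
      rw [aeval_eq_sum_range]
      refine V.toSubring.sum_mem fun i _ => ?_
      rw [Algebra.smul_def]
      exact V.mul_mem _ _ (hRV (isIntegral_algebraMap (R := k))) (V.toSubring.pow_mem hx i)
    have hnot (x : B) (hx : aeval x f = aeval a f) : algebraMap B K x ∉ V := fun h => hV <| by
      rw [← hx, ← aeval_algebraMap_apply]
      exact hmem _ h
    have ha := hnot a rfl
    have hb := (V.mem_or_inv_mem _).resolve_left (hnot b hab)
    have hc := (V.mem_or_inv_mem _).resolve_left (hnot c (hbc.trans hab))
    refine ha ?_
    have hprod : algebraMap B K a * algebraMap B K b * algebraMap B K c = 1 := by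
      rw [← map_mul, ← map_mul, habc, map_one]
    have hb0 : algebraMap B K b ≠ 0 := by rintro h0; simp [h0] at hprod
    have hc0 : algebraMap B K c ≠ 0 := by rintro h0; simp [h0] at hprod
    have : algebraMap B K a = (algebraMap B K b)⁻¹ * (algebraMap B K c)⁻¹ := by
      rw [← mul_inv]
      exact eq_inv_of_mul_eq_one_left (by rw [← mul_assoc, hprod])
    rw [this]
    exact V.mul_mem _ _ hb hc
  have hv' : IsAlgebraic k (aeval a f) :=
    (isAlgebraic_algebraMap_iff hinj).mp hv.isAlgebraic
  have hroot (x : B) (hx : aeval x f = aeval a f) : IsIntegral k x := by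
    refine IsAlgebraic.isIntegral ?_
    obtain ⟨q, hq, hq0⟩ := hv'
    refine ⟨q.comp f, fun h => ?_, by rw [aeval_comp, hx, hq0]⟩
    rcases comp_eq_zero_iff.mp h with h | ⟨-, h⟩
    · exact hq h
    · rw [h, natDegree_C] at hf
      omega
  exact ⟨hroot a rfl, hroot b hab⟩

/-- If `b` is a nonzerodivisor modulo `a`, then it remains so after localization. -/
lemma IsLocalization.dvd_of_dvd_mul {R S : Type*} [CommRing R] [CommRing S] [Algebra R S]
    (M : Submonoid R) [IsLocalization M S] {a b : R} (h : ∀ z, a ∣ b * z → a ∣ z) {z : S}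
    (hz : algebraMap R S a ∣ algebraMap R S b * z) : algebraMap R S a ∣ z := by
  obtain ⟨w, hw⟩ := hz
  obtain ⟨z', w', d, hz', hw'⟩ := IsLocalization.surj₂ M S z w
  obtain ⟨c, hc⟩ := IsLocalization.exists_of_eq (M := M) (S := S) (x := b * z') (y := a * w') (by
    rw [map_mul, map_mul, ← hz', ← hw', ← mul_assoc, hw, mul_assoc])
  obtain ⟨v, hv⟩ := h (c * z') ⟨c * w', by linear_combination hc⟩
  have hu : IsUnit (algebraMap R S c * algebraMap R S d) :=
    (IsLocalization.map_units S c).mul (IsLocalization.map_units S d)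
  rw [← hu.dvd_mul_left]
  refine ⟨algebraMap R S v, ?_⟩
  rw [← map_mul _ a, ← hv, map_mul, ← hz']
  ring

open Polynomial in
/-- A polynomial having a unit among its coefficients is coprime to every nonzero constant. -/
lemma Polynomial.isRelPrime_C_of_isUnit_coeff {R : Type*} [CommRing R] [IsDomain R] {g : R}
    (hg : g ≠ 0) {p : R[X]} {n : ℕ} (hp : IsUnit (p.coeff n)) : IsRelPrime (C g) p := by
  intro d hdg hdp
  have hdeg : d.natDegree = 0 := by
    have := natDegree_le_of_dvd hdg (C_ne_zero.mpr hg)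
    rwa [natDegree_C, Nat.le_zero] at this
  rw [eq_C_of_natDegree_eq_zero hdeg] at hdp ⊢
  exact isUnit_C.mpr (isUnit_of_dvd_unit (C_dvd_iff_dvd_coeff _ _ |>.mp hdp n) hp)

/-- Laurent polynomials in two variables as iterated Laurent polynomials, with outer variable
`t₁` and inner variable `t₂`. -/
def laurentTwoEquiv : LaurentTwo ≃ₐ[ℚ] LaurentPolynomial (LaurentPolynomial ℚ) :=
  AddMonoidAlgebra.curryAlgEquiv ℚ

lemma laurentTwoEquiv_aeval_t₁ (q : Polynomial ℚ) :
    laurentTwoEquiv (Polynomial.aeval t₁ q) =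
      Polynomial.toLaurent (q.map (algebraMap ℚ (LaurentPolynomial ℚ))) := by
  have h : laurentTwoEquiv t₁ = LaurentPolynomial.T 1 :=
    AddMonoidAlgebra.curryAlgEquiv_single ..
  rw [← Polynomial.aeval_algHom_apply, h, ← Polynomial.toLaurent_X,
    ← Polynomial.coe_toLaurentAlg, ← Polynomial.aeval_map_algebraMap (LaurentPolynomial ℚ),
    Polynomial.aeval_algHom_apply, Polynomial.aeval_X_left_apply]

lemma laurentTwoEquiv_aeval_t₂ (q : Polynomial ℚ) :
    laurentTwoEquiv (Polynomial.aeval t₂ q) =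
      LaurentPolynomial.C (Polynomial.toLaurent q) := by
  have h : laurentTwoEquiv t₂ = LaurentPolynomial.C (LaurentPolynomial.T 1) :=
    AddMonoidAlgebra.curryAlgEquiv_single ..
  rw [← Polynomial.aeval_algHom_apply, h, ← Polynomial.toLaurent_X,
    ← Polynomial.coe_toLaurentAlg, LaurentPolynomial.C_eq_algebraMap,
    Polynomial.aeval_algebraMap_apply, Polynomial.aeval_algHom_apply,
    Polynomial.aeval_X_left_apply, LaurentPolynomial.C_eq_algebraMap]

instance LaurentPolynomial.uniqueFactorizationMonoid {R : Type*} [CommRing R] [IsDomain R]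
    [UniqueFactorizationMonoid R] : UniqueFactorizationMonoid (LaurentPolynomial R) :=
  .of_isLocalization (Submonoid.powers (Polynomial.X : Polynomial R)) _

instance LaurentTwo.uniqueFactorizationMonoid : UniqueFactorizationMonoid LaurentTwo :=
  laurentTwoEquiv.symm.toMulEquiv.uniqueFactorizationMonoid inferInstance

lemma t₁_mul_t₂_mul_t₃ : t₁ * t₂ * t₃ = 1 := by
  simp [t₁, t₂, t₃, AddMonoidAlgebra.single_mul_single, AddMonoidAlgebra.one_def, Prod.zero_eq_mk]

lemma dvd_of_aeval_t₂_dvd_aeval_t₁_mul {g h : Polynomial ℚ} (hg : g ≠ 0) (hh : h ≠ 0)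
    {z : LaurentTwo} (hz : Polynomial.aeval t₂ g ∣ Polynomial.aeval t₁ h * z) :
    Polynomial.aeval t₂ g ∣ z := by
  have hrel : IsRelPrime (Polynomial.C (Polynomial.toLaurent g))
      (h.map (algebraMap ℚ (LaurentPolynomial ℚ))) := by
    refine Polynomial.isRelPrime_C_of_isUnit_coeff (Polynomial.toLaurent_ne_zero.mpr hg)
      (n := h.natDegree) ?_
    rw [Polynomial.coeff_map]
    exact (Polynomial.leadingCoeff_ne_zero.mpr hh).isUnit.map _
  rw [← map_dvd_iff laurentTwoEquiv] at hz ⊢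
  rw [map_mul, laurentTwoEquiv_aeval_t₁, laurentTwoEquiv_aeval_t₂, ← Polynomial.toLaurent_C,
    ← LaurentPolynomial.algebraMap_eq_toLaurent, ← LaurentPolynomial.algebraMap_eq_toLaurent] at *
  exact IsLocalization.dvd_of_dvd_mul
    (Submonoid.powers (Polynomial.X : Polynomial (LaurentPolynomial ℚ)))
    (fun _ => hrel.dvd_of_dvd_mul_left) hz

/-- No prime of `ℚ[t₁^{±1}, t₂^{±1}]` divides both a nonzero polynomial in `t₁` and a nonzero
polynomial in `t₂`. -/
lemma not_prime_of_dvd_aeval {g h : Polynomial ℚ} (hg : g ≠ 0) (hh : h ≠ 0) {p : LaurentTwo}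
    (hpg : p ∣ Polynomial.aeval t₂ g) (hph : p ∣ Polynomial.aeval t₁ h) : ¬ Prime p := by
  intro hp
  obtain ⟨a, ha⟩ := hpg
  obtain ⟨b, hb⟩ := hph
  have hg0 : Polynomial.aeval t₂ g ≠ 0 := by
    rw [← EmbeddingLike.map_ne_zero_iff (f := laurentTwoEquiv), laurentTwoEquiv_aeval_t₂, ← Polynomial.toLaurent_C,
      Polynomial.toLaurent_ne_zero, Polynomial.C_ne_zero, Polynomial.toLaurent_ne_zero]
    exact hg
  have hdvd : Polynomial.aeval t₂ g ∣ a :=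
    dvd_of_aeval_t₂_dvd_aeval_t₁_mul hg hh ⟨b, by rw [ha, hb]; ring⟩
  have ha0 : a ≠ 0 := by rintro rfl; simp [hg0] at ha
  obtain ⟨c, hc⟩ := hdvd
  refine hp.not_isUnit (.of_mul_eq_one c (mul_right_cancel₀ ha0 ?_))
  rw [one_mul]
  conv_rhs => rw [hc, ha]
  ring

lemma aeval_t₂_sub_aeval_t₁_ne_zero {f : Polynomial ℚ} (hf : 1 ≤ f.natDegree) :
    Polynomial.aeval t₂ f - Polynomial.aeval t₁ f ≠ 0 := by
  intro h
  have h' := congrArg laurentTwoEquiv (sub_eq_zero.mp h)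
  rw [laurentTwoEquiv_aeval_t₁, laurentTwoEquiv_aeval_t₂, ← Polynomial.toLaurent_C,
    Polynomial.toLaurent_inj] at h'
  have hdeg := congrArg Polynomial.natDegree h'
  rw [Polynomial.natDegree_C, Polynomial.natDegree_map] at hdeg
  omega

lemma isRelPrime_aeval_sub_aeval {f : Polynomial ℚ} (hf : 1 ≤ f.natDegree) :
    IsRelPrime (Polynomial.aeval t₂ f - Polynomial.aeval t₁ f)
      (Polynomial.aeval t₃ f - Polynomial.aeval t₂ f) := by
  rw [UniqueFactorizationMonoid.isRelPrime_iff_no_prime_factors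
    (aeval_t₂_sub_aeval_t₁_ne_zero hf)]
  intro p hp₁ hp₂ hp
  let I := Ideal.span {p}
  have : I.IsPrime := (Ideal.span_singleton_prime hp.ne_zero).mpr hp
  let π := Ideal.Quotient.mkₐ ℚ I
  have hπ (x : LaurentTwo) : π x = 0 ↔ p ∣ x :=
    Ideal.Quotient.eq_zero_iff_mem.trans Ideal.mem_span_singleton
  rw [← hπ, map_sub, sub_eq_zero, ← Polynomial.aeval_algHom_apply,
    ← Polynomial.aeval_algHom_apply] at hp₁ hp₂
  obtain ⟨⟨h, hh, hh0⟩, g, hg, hg0⟩ := isIntegral_of_aeval_eq_of_mul_eq_one hf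
    (by rw [← map_mul, ← map_mul, t₁_mul_t₂_mul_t₃, map_one]) hp₁ hp₂
  rw [← Polynomial.aeval_def, Polynomial.aeval_algHom_apply, hπ] at hh0 hg0
  exact not_prime_of_dvd_aeval hg.ne_zero hh.ne_zero hg0 hh0 hp

lemma x₁_mem_nonZeroDivisors {f : Polynomial ℚ} (hf : 1 ≤ f.natDegree) :
    x₁ f ∈ nonZeroDivisors (LocLaurentTwo f) :=
  IsLocalization.map_nonZeroDivisors_le (Submonoid.powers (Polynomial.aeval t₁ f *
    Polynomial.aeval t₂ f * Polynomial.aeval t₃ f)) _ <| Submonoid.mem_map_of_mem _ <|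
    mem_nonZeroDivisors_of_ne_zero (aeval_t₂_sub_aeval_t₁_ne_zero hf)

lemma x₁_dvd_of_dvd_x₂_mul {f : Polynomial ℚ} (hf : 1 ≤ f.natDegree) {z : LocLaurentTwo f}
    (hz : x₁ f ∣ x₂ f * z) : x₁ f ∣ z :=
  IsLocalization.dvd_of_dvd_mul (Submonoid.powers (Polynomial.aeval t₁ f *
      Polynomial.aeval t₂ f * Polynomial.aeval t₃ f))
    (fun _ => (isRelPrime_aeval_sub_aeval hf).dvd_of_dvd_mul_left) hz

/-- The Koszul complex `0 → R → R ⊕ R → R → 0` of the sequence `(x₁, x₂)`, with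
`d⁰(r) = (x₁r, x₂r)` and `d¹(y₁,y₂) = x₂y₁ − x₁y₂`, satisfies: `d¹ ∘ d⁰ = 0`, `d⁰` is
injective, `ker d¹ = im d⁰`, and `coker d¹ ≅ R/(x₁, x₂)` as `R`-modules. -/
theorem koszul_complex_exactness (f : Polynomial ℚ) (hf : 1 ≤ f.natDegree)
    (d0 : LocLaurentTwo f →ₗ[LocLaurentTwo f] LocLaurentTwo f × LocLaurentTwo f)
    (hd0 : ∀ r, d0 r = (x₁ f * r, x₂ f * r))
    (d1 : LocLaurentTwo f × LocLaurentTwo f →ₗ[LocLaurentTwo f] LocLaurentTwo f)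
    (hd1 : ∀ y, d1 y = x₂ f * y.1 - x₁ f * y.2) :
    (∀ r, d1 (d0 r) = 0) ∧
    Function.Injective d0 ∧
    LinearMap.ker d1 = LinearMap.range d0 ∧
    Nonempty ((LocLaurentTwo f ⧸ LinearMap.range d1) ≃ₗ[LocLaurentTwo f]
      (LocLaurentTwo f ⧸ Ideal.span {x₁ f, x₂ f})) := by
  have hx₁ {a b : LocLaurentTwo f} (h : x₁ f * a = x₁ f * b) : a = b :=
    (mul_cancel_left_mem_nonZeroDivisors (x₁_mem_nonZeroDivisors hf)).mp h
  have hcomp (r) : d1 (d0 r) = 0 := by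
    rw [hd1, hd0]
    ring
  refine ⟨hcomp, fun r s h => ?_, le_antisymm (fun y hy => ?_) ?_,
    ⟨Submodule.quotEquivOfEq _ _ (le_antisymm ?_ ?_)⟩⟩
  · rw [hd0, hd0] at h
    exact hx₁ (Prod.mk.inj h).1
  · rw [LinearMap.mem_ker, hd1, sub_eq_zero] at hy
    obtain ⟨r, hr⟩ := x₁_dvd_of_dvd_x₂_mul hf ⟨_, hy⟩
    refine ⟨r, ?_⟩
    rw [hd0]
    refine Prod.ext hr.symm (hx₁ ?_)
    rw [← hy, hr]
    ring
  · rintro _ ⟨r, rfl⟩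
    exact hcomp r
  · rintro _ ⟨y, rfl⟩
    rw [hd1]
    exact Ideal.sub_mem _ (Ideal.mul_mem_right _ _ (Ideal.subset_span (by simp)))
      (Ideal.mul_mem_right _ _ (Ideal.subset_span (by simp)))
  · refine Ideal.span_le.mpr ?_
    rintro _ (rfl | rfl)
    · exact ⟨(0, -1), by rw [hd1]; ring⟩
    · exact ⟨(1, 0), by rw [hd1]; ring⟩
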